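/- arXiv:1111.5843 — 4 statements merged into one kernel-verified Lean document; each statement's English description precedes it below -/
import Mathlib

section
/- Let d ≥ 1, let ξ : ℝ^d → ℝ be differentiable, and suppose τ : ℝ^d × ℝ^d → ℝ is differentiable at (x₀, v₀) and satisfies ξ(x − τ(x,v) v) = 0 for all (x,v) in a neighborhood of (x₀, v₀). Set x_b = x₀ − τ(x₀,v₀) v₀ and assume ⟨∇ξ(x_b), v₀⟩ ≠ 0. Then the exit-point map X_b(x,v) = x − τ(x,v) v is differentiable at (x₀,v₀) with partial derivatives ∂(X_b)_i/∂x_j = δ_{ij} − (v₀)_i (∇ξ(x_b))_j / ⟨∇ξ(x_b), v₀⟩ and ∂(X_b)_i/∂v_j = −τ(x₀,v₀) · (δ_{ij} − (v₀)_i (∇ξ(x_b))_j / ⟨∇ξ(x_b), v₀⟩) for all i, j. -/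
open scoped RealInnerProductSpace Topology

/-- The (oblique) projection along `v` onto the orthogonal complement of `g`. -/
noncomputable def obliqueProjection {E : Type*} [NormedAddCommGroup E] [InnerProductSpace ℝ E]
    (g v : E) : E →L[ℝ] E :=
  ContinuousLinearMap.id ℝ E - (⟪g, v⟫⁻¹ • innerSL ℝ g).smulRight v

/-- Implicit differentiation of the exit point in an arbitrary Hilbert space. -/
theorem hasFDerivAt_exitPoint {E : Type*} [NormedAddCommGroup E] [InnerProductSpace ℝ E]
    [CompleteSpace E] {ξ : E → ℝ} {τ : E × E → ℝ} {x₀ v₀ : E}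
    (hξ : DifferentiableAt ℝ ξ (x₀ - τ (x₀, v₀) • v₀))
    (hτ : DifferentiableAt ℝ τ (x₀, v₀))
    (hrel : ∀ᶠ p : E × E in 𝓝 (x₀, v₀), ξ (p.1 - τ p • p.2) = 0)
    (hne : ⟪gradient ξ (x₀ - τ (x₀, v₀) • v₀), v₀⟫ ≠ 0) :
    HasFDerivAt (fun p : E × E => p.1 - τ p • p.2)
      ((obliqueProjection (gradient ξ (x₀ - τ (x₀, v₀) • v₀)) v₀).comp
        (ContinuousLinearMap.fst ℝ E E - τ (x₀, v₀) • ContinuousLinearMap.snd ℝ E E))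
      (x₀, v₀) := by
  set g := gradient ξ (x₀ - τ (x₀, v₀) • v₀) with hg
  have hX : HasFDerivAt (fun p : E × E => p.1 - τ p • p.2) _ (x₀, v₀) :=
    hasFDerivAt_fst.sub (hτ.hasFDerivAt.smul hasFDerivAt_snd)
  have hcomp := (hξ.hasGradientAt.hasFDerivAt).comp (x₀, v₀) hX
  have hzero : HasFDerivAt (ξ ∘ fun p : E × E => p.1 - τ p • p.2) (0 : E × E →L[ℝ] ℝ) (x₀, v₀) :=
    (hasFDerivAt_const (0 : ℝ) (x₀, v₀)).congr_of_eventuallyEq hrel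
  have heq := hcomp.unique hzero
  refine hX.congr_fderiv ?_
  refine ContinuousLinearMap.ext fun w => ?_
  have hw := DFunLike.congr_fun heq w
  simp only [ContinuousLinearMap.comp_apply, InnerProductSpace.toDual_apply_apply,
    ← hg, sub_apply, add_apply, smul_apply,
    ContinuousLinearMap.smulRight_apply, ContinuousLinearMap.coe_fst',
    ContinuousLinearMap.coe_snd', zero_apply, inner_sub_right,
    inner_add_right, inner_smul_right] at hw
  have hT : fderiv ℝ τ (x₀, v₀) w = ⟪g, v₀⟫⁻¹ * (⟪g, w.1⟫ - τ (x₀, v₀) * ⟪g, w.2⟫) := by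
    field_simp
    linarith
  simp only [obliqueProjection, ContinuousLinearMap.comp_apply, ContinuousLinearMap.id_apply,
    sub_apply, add_apply, smul_apply,
    ContinuousLinearMap.smulRight_apply, ContinuousLinearMap.coe_fst',
    ContinuousLinearMap.coe_snd', innerSL_apply_apply, inner_sub_right, inner_smul_right, hT,
    smul_eq_mul]
  abel

/-- The matrix entries of `obliqueProjection` in the standard basis. -/
theorem obliqueProjection_single_apply {ι : Type*} [Fintype ι] [DecidableEq ι]
    (g v : EuclideanSpace ℝ ι) (i j : ι) :
    obliqueProjection g v (EuclideanSpace.single j 1) i =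
      (if i = j then (1 : ℝ) else 0) - v i * g j / ⟪g, v⟫ := by
  simp [obliqueProjection, EuclideanSpace.inner_single_right]
  ring

/-- Implicit differentiation of the backward exit point `X_b(x,v) = x − τ(x,v)·v`: under the
implicit-function hypotheses on the defining function `ξ` and the exit time `τ`, the map `X_b`
is differentiable at `(x₀,v₀)` with partial derivatives
`∂(X_b)_i/∂x_j = δ_{ij} − v_i (∇ξ(x_b))_j/⟨∇ξ(x_b),v₀⟩` and
`∂(X_b)_i/∂v_j = −τ·(δ_{ij} − v_i (∇ξ(x_b))_j/⟨∇ξ(x_b),v₀⟩)`. -/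
theorem exit_point_partial_derivatives
    (d : ℕ) (hd : 1 ≤ d)
    (ξ : EuclideanSpace ℝ (Fin d) → ℝ) (hξ : Differentiable ℝ ξ)
    (τ : EuclideanSpace ℝ (Fin d) × EuclideanSpace ℝ (Fin d) → ℝ)
    (x₀ v₀ : EuclideanSpace ℝ (Fin d))
    (hτ : DifferentiableAt ℝ τ (x₀, v₀))
    (hrel : ∀ᶠ p : EuclideanSpace ℝ (Fin d) × EuclideanSpace ℝ (Fin d) in 𝓝 (x₀, v₀),
      ξ (p.1 - τ p • p.2) = 0)
    (hne : ⟪gradient ξ (x₀ - τ (x₀, v₀) • v₀), v₀⟫ ≠ 0) :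
    DifferentiableAt ℝ
      (fun p : EuclideanSpace ℝ (Fin d) × EuclideanSpace ℝ (Fin d) => p.1 - τ p • p.2)
      (x₀, v₀) ∧
    (∀ i j : Fin d,
      fderiv ℝ (fun x => (x - τ (x, v₀) • v₀) i) x₀ (EuclideanSpace.single j 1) =
        (if i = j then (1 : ℝ) else 0) -
          v₀ i * gradient ξ (x₀ - τ (x₀, v₀) • v₀) j /
            ⟪gradient ξ (x₀ - τ (x₀, v₀) • v₀), v₀⟫) ∧
    (∀ i j : Fin d,
      fderiv ℝ (fun v => (x₀ - τ (x₀, v) • v) i) v₀ (EuclideanSpace.single j 1) =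
        -τ (x₀, v₀) *
          ((if i = j then (1 : ℝ) else 0) -
            v₀ i * gradient ξ (x₀ - τ (x₀, v₀) • v₀) j /
              ⟪gradient ξ (x₀ - τ (x₀, v₀) • v₀), v₀⟫)) := by
  have hX := hasFDerivAt_exitPoint (hξ _) hτ hrel hne
  refine ⟨hX.differentiableAt, fun i j => ?_, fun i j => ?_⟩
  · have hx := (EuclideanSpace.proj (𝕜 := ℝ) i).hasFDerivAt.comp x₀
      (hX.comp x₀ (hasFDerivAt_prodMk_left x₀ v₀))
    refine (DFunLike.congr_fun hx.fderiv _).trans ?_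
    rw [← obliqueProjection_single_apply]
    simp
  · have hv := (EuclideanSpace.proj (𝕜 := ℝ) i).hasFDerivAt.comp v₀
      (hX.comp v₀ (hasFDerivAt_prodMk_right x₀ v₀))
    refine (DFunLike.congr_fun hv.fderiv _).trans ?_
    rw [← obliqueProjection_single_apply]
    simp
end

section
/- Let ξ : ℝ² → ℝ be differentiable, let x ∈ ℝ², write u(θ) = (cos θ, sin θ), and suppose τ : ℝ → ℝ is differentiable at θ₀ and satisfies ξ(x − τ(θ) u(θ)) = 0 for all θ in a neighborhood of θ₀. Set x_b = x − τ(θ₀) u(θ₀) and assume ⟨∇ξ(x_b), u(θ₀)⟩ ≠ 0. Then τ'(θ₀) = τ(θ₀) · ⟨∇ξ(x_b), (sin θ₀, −cos θ₀)⟩ / ⟨∇ξ(x_b), u(θ₀)⟩. -/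
open scoped RealInnerProductSpace Topology

/-- The unit direction `u(θ) = (cos θ, sin θ)` in `ℝ²`. -/
noncomputable def uvec (θ : ℝ) : EuclideanSpace ℝ (Fin 2) :=
  (WithLp.equiv 2 (Fin 2 → ℝ)).symm ![Real.cos θ, Real.sin θ]

/-- The rotated direction `(sin θ, −cos θ)` in `ℝ²`. -/
noncomputable def uperp (θ : ℝ) : EuclideanSpace ℝ (Fin 2) :=
  (WithLp.equiv 2 (Fin 2 → ℝ)).symm ![Real.sin θ, -Real.cos θ]

theorem hasDerivAt_uvec (θ : ℝ) : HasDerivAt uvec (-uperp θ) θ := by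
  rw [hasDerivAt_iff_hasFDerivAt, ← hasFDerivWithinAt_univ, hasFDerivWithinAt_euclidean]
  intro i
  rw [hasFDerivWithinAt_univ, hasFDerivAt_iff_hasDerivAt]
  fin_cases i
  · simpa [uvec, uperp] using Real.hasDerivAt_cos θ
  · simpa [uvec, uperp] using Real.hasDerivAt_sin θ

/-- Angular derivative of the planar backward exit time: if `ξ` is a differentiable defining
function, `τ` is differentiable at `θ₀` with `ξ(x − τ(θ) u(θ)) = 0` near `θ₀`, and
`⟨∇ξ(x_b), u(θ₀)⟩ ≠ 0` at the exit point `x_b = x − τ(θ₀) u(θ₀)`, then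
`τ'(θ₀) = τ(θ₀)·⟨∇ξ(x_b), (sin θ₀, −cos θ₀)⟩ / ⟨∇ξ(x_b), u(θ₀)⟩`. -/
theorem exit_time_angular_derivative
    (ξ : EuclideanSpace ℝ (Fin 2) → ℝ) (hξ : Differentiable ℝ ξ)
    (x : EuclideanSpace ℝ (Fin 2)) (τ : ℝ → ℝ) (θ₀ : ℝ)
    (hτ : DifferentiableAt ℝ τ θ₀)
    (hrel : ∀ᶠ θ in 𝓝 θ₀, ξ (x - τ θ • uvec θ) = 0)
    (hne : ⟪gradient ξ (x - τ θ₀ • uvec θ₀), uvec θ₀⟫ ≠ 0) :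
    deriv τ θ₀ =
      τ θ₀ * ⟪gradient ξ (x - τ θ₀ • uvec θ₀), uperp θ₀⟫ /
        ⟪gradient ξ (x - τ θ₀ • uvec θ₀), uvec θ₀⟫ := by
  have hcurve : HasDerivAt (fun θ => x - τ θ • uvec θ)
      (-(τ θ₀ • -uperp θ₀ + deriv τ θ₀ • uvec θ₀)) θ₀ :=
    (hτ.hasDerivAt.smul (hasDerivAt_uvec θ₀)).const_sub x
  have hcomp := (hξ (x - τ θ₀ • uvec θ₀)).hasGradientAt.hasFDerivAt.comp_hasDerivAt θ₀ hcurve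
  have hzero := hcomp.unique ((hasDerivAt_const θ₀ (0 : ℝ)).congr_of_eventuallyEq hrel)
  simp only [InnerProductSpace.toDual_apply_apply, inner_neg_right, inner_add_right,
    real_inner_smul_right] at hzero
  rw [eq_div_iff hne]
  linarith
end

section
/- For every real β > 5 there is a constant C = C(β) > 0 such that for every ζ ∈ [0, 1/4), every ϱ ≥ 1, and every unit vector n ∈ ℝ³, ∫_{v ∈ ℝ³, ⟨v,n⟩ > 0} ⟨v⟩ · w̃_ϱ(v) · μ(v) ⟨v,n⟩ dv ≤ C ϱ⁻⁴, where w̃_ϱ(v) = √(2π) e^{(1/4 − ζ)‖v‖²} (1 + ϱ²‖v‖²)^{−β/2} and ⟨v⟩ = √(1 + ‖v‖²). -/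
open MeasureTheory
open scoped RealInnerProductSpace

/-- The boundary integrand, written in terms of `r = ‖v‖` and `t = ⟪v, n⟫`, is dominated by a
rescaled power of the Japanese bracket. -/
lemma boundary_integrand_le {β ζ ϱ r t : ℝ} (hζ : 0 ≤ ζ) (hϱ : 1 ≤ ϱ) (ht : 0 ≤ t) (htr : t ≤ r) :
    Real.sqrt (1 + r ^ 2) *
        (Real.sqrt (2 * Real.pi) * Real.exp ((1 / 4 - ζ) * r ^ 2) *
          (1 + ϱ ^ 2 * r ^ 2) ^ (-(β / 2))) *
        ((2 * Real.pi)⁻¹ * Real.exp (-r ^ 2 / 2) * t) ≤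
      2 / ϱ * (1 + (ϱ * r) ^ 2) ^ (-(β - 1) / 2) := by
  have hr : 0 ≤ r := ht.trans htr
  have hϱ0 : 0 < ϱ := by linarith
  have h_exp : Real.sqrt (1 + r ^ 2) *
      (Real.exp ((1 / 4 - ζ) * r ^ 2) * Real.exp (-r ^ 2 / 2)) ≤ 2 := by
    have h_sqrt : Real.sqrt (1 + r ^ 2) ≤ 2 * Real.exp (r ^ 2 / 4) := by
      have h := Real.add_one_le_exp (r ^ 2 / 4)
      refine Real.sqrt_le_iff.2 ⟨by positivity, ?_⟩
      nlinarith [sq_nonneg r]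
    calc _ ≤ 2 * Real.exp (r ^ 2 / 4) * Real.exp (-(r ^ 2 / 4)) := by
          rw [← Real.exp_add]
          gcongr
          nlinarith [mul_nonneg hζ (sq_nonneg r)]
      _ = 2 := by rw [mul_assoc, ← Real.exp_add]; simp
  have h_pi : Real.sqrt (2 * Real.pi) * (2 * Real.pi)⁻¹ ≤ 1 := by
    have h := Real.pi_gt_three
    rw [← div_eq_mul_inv, div_le_one (by positivity), Real.sqrt_le_iff]
    exact ⟨by positivity, by nlinarith⟩
  have h_pow : (1 + ϱ ^ 2 * r ^ 2) ^ (-(β / 2)) * t ≤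
      1 / ϱ * (1 + (ϱ * r) ^ 2) ^ (-(β - 1) / 2) := by
    have h_split : (1 + (ϱ * r) ^ 2) ^ (-(β - 1) / 2) =
        (1 + ϱ ^ 2 * r ^ 2) ^ (-(β / 2)) * Real.sqrt (1 + (ϱ * r) ^ 2) := by
      rw [Real.sqrt_eq_rpow, mul_pow, ← Real.rpow_add (by positivity)]
      congr 1
      ring
    have h_le : ϱ * r ≤ Real.sqrt (1 + (ϱ * r) ^ 2) := Real.le_sqrt_of_sq_le (by linarith)
    have h_t : t ≤ 1 / ϱ * Real.sqrt (1 + (ϱ * r) ^ 2) := by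
      rw [one_div, ← div_eq_inv_mul, le_div_iff₀ hϱ0]
      nlinarith
    rw [h_split, mul_left_comm]
    gcongr
  calc _ = (Real.sqrt (1 + r ^ 2) *
          (Real.exp ((1 / 4 - ζ) * r ^ 2) * Real.exp (-r ^ 2 / 2))) *
        (Real.sqrt (2 * Real.pi) * (2 * Real.pi)⁻¹) *
        ((1 + ϱ ^ 2 * r ^ 2) ^ (-(β / 2)) * t) := by ring
    _ ≤ 2 * 1 * (1 / ϱ * (1 + (ϱ * r) ^ 2) ^ (-(β - 1) / 2)) := by gcongr
    _ = _ := by ring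

/-- For every `β > 5` there is `C = C(β) > 0` such that for all `ζ ∈ [0, 1/4)`, all `ϱ ≥ 1`
and every unit vector `n`,
`∫_{⟨v,n⟩ > 0} ⟨v⟩ · w̃_ϱ(v) · μ(v) ⟨v,n⟩ dv ≤ C ϱ⁻⁴`, where
`w̃_ϱ(v) = √(2π) e^{(1/4 − ζ)‖v‖²} (1 + ϱ²‖v‖²)^{−β/2}`, `⟨v⟩ = √(1 + ‖v‖²)`, and
`μ(v) = (2π)⁻¹ e^{−‖v‖²/2}`. -/
theorem boundary_weight_integral_bound :
    ∀ β : ℝ, 5 < β → ∃ C : ℝ, 0 < C ∧ ∀ ζ : ℝ, 0 ≤ ζ → ζ < 1 / 4 → ∀ ϱ : ℝ, 1 ≤ ϱ →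
      ∀ n : EuclideanSpace ℝ (Fin 3), ‖n‖ = 1 →
      (∫ v in {v : EuclideanSpace ℝ (Fin 3) | 0 < ⟪v, n⟫},
        Real.sqrt (1 + ‖v‖ ^ 2) *
          (Real.sqrt (2 * Real.pi) * Real.exp ((1 / 4 - ζ) * ‖v‖ ^ 2) *
            (1 + ϱ ^ 2 * ‖v‖ ^ 2) ^ (-(β / 2))) *
          ((2 * Real.pi)⁻¹ * Real.exp (-‖v‖ ^ 2 / 2) * ⟪v, n⟫)) ≤ C / ϱ ^ 4 := by
  intro β hβ
  have h_int : Integrable fun v : EuclideanSpace ℝ (Fin 3) ↦ (1 + ‖v‖ ^ 2) ^ (-(β - 1) / 2) :=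
    integrable_rpow_neg_one_add_norm_sq (by
      rw [finrank_euclideanSpace_fin]
      norm_num
      linarith)
  have h_nonneg : 0 ≤ ∫ v : EuclideanSpace ℝ (Fin 3), (1 + ‖v‖ ^ 2) ^ (-(β - 1) / 2) :=
    integral_nonneg fun v ↦ by positivity
  refine ⟨2 * (∫ v : EuclideanSpace ℝ (Fin 3), (1 + ‖v‖ ^ 2) ^ (-(β - 1) / 2)) + 1,
    by linarith, fun ζ hζ _ ϱ hϱ n hn ↦ ?_⟩
  have hϱ0 : 0 < ϱ := by linarith
  have h_scaled : Integrable fun v : EuclideanSpace ℝ (Fin 3) ↦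
      2 / ϱ * (1 + ‖ϱ • v‖ ^ 2) ^ (-(β - 1) / 2) :=
    (h_int.comp_smul hϱ0.ne').const_mul _
  have h_meas : MeasurableSet {v : EuclideanSpace ℝ (Fin 3) | 0 < ⟪v, n⟫} :=
    measurableSet_lt (by fun_prop) (by fun_prop)
  calc _ ≤ ∫ v in {v : EuclideanSpace ℝ (Fin 3) | 0 < ⟪v, n⟫},
        2 / ϱ * (1 + ‖ϱ • v‖ ^ 2) ^ (-(β - 1) / 2) := by
        refine integral_mono_of_nonneg ?_ h_scaled.integrableOn ?_
        · refine (ae_restrict_iff' h_meas).2 (.of_forall fun v (hv : 0 < ⟪v, n⟫) ↦ ?_)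
          simp only [Pi.zero_apply]
          positivity
        · refine (ae_restrict_iff' h_meas).2 (.of_forall fun v (hv : 0 < ⟪v, n⟫) ↦ ?_)
          have h := boundary_integrand_le (β := β) hζ hϱ hv.le
            (by simpa [hn] using real_inner_le_norm v n)
          simpa only [norm_smul, Real.norm_of_nonneg hϱ0.le] using h
    _ ≤ ∫ v : EuclideanSpace ℝ (Fin 3), 2 / ϱ * (1 + ‖ϱ • v‖ ^ 2) ^ (-(β - 1) / 2) :=
        setIntegral_le_integral h_scaled (.of_forall fun v ↦ by
          simp only [Pi.zero_apply]
          positivity)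
    _ = 2 * (∫ v : EuclideanSpace ℝ (Fin 3), (1 + ‖v‖ ^ 2) ^ (-(β - 1) / 2)) / ϱ ^ 4 := by
        rw [integral_const_mul, Measure.integral_comp_smul_of_nonneg volume
          (fun v : EuclideanSpace ℝ (Fin 3) ↦ (1 + ‖v‖ ^ 2) ^ (-(β - 1) / 2)) ϱ (hR := hϱ0.le),
          finrank_euclideanSpace_fin, smul_eq_mul]
        field_simp
    _ ≤ _ := by
        gcongr
        linarith
end

section
/- Let (x_n)_{n ≥ 0} be a sequence of nonnegative real numbers, let k ≥ 1 be an integer, let θ ∈ [0, 1), and let D ≥ 0. Suppose that for every n ≥ k one has x_n ≤ θ · max{ x_{n−k}, x_{n−k+1}, …, x_{n−1} } + D. Then for every i ≥ 0 and every n with i·k ≤ n < (i+1)·k, x_n ≤ θ^i · max{ x_0, …, x_{k−1} } + D/(1−θ). In particular, sup_n x_n ≤ max{ x_0, …, x_{k−1} } + D/(1−θ). -/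
/-- If a sequence is bounded by `M` on its first `k` terms and each later term is at most
`θ · max` of the preceding `k` terms plus `D`, then every term of index at least `i * k` is at
most `θ ^ i * M + D / (1 - θ)`. -/
theorem le_pow_mul_add_of_window_rec {x : ℕ → ℝ} {k : ℕ} (hk : 1 ≤ k) {θ D M : ℝ}
    (hθ0 : 0 ≤ θ) (hθ1 : θ < 1) (hD : 0 ≤ D) (hM : 0 ≤ M) (hinit : ∀ n < k, x n ≤ M)
    (hrec : ∀ n, k ≤ n → x n ≤ θ * sSup (x '' Set.Icc (n - k) (n - 1)) + D)
    (i n : ℕ) (hin : i * k ≤ n) : x n ≤ θ ^ i * M + D / (1 - θ) := by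
  induction n using Nat.strong_induction_on generalizing i with
  | _ n ih =>
    have hE : 0 ≤ D / (1 - θ) := div_nonneg hD (by linarith)
    have hfix : θ * (D / (1 - θ)) + D = D / (1 - θ) := by
      have : 1 - θ ≠ 0 := by linarith
      field_simp
      ring
    rcases lt_or_ge n k with hn | hn
    · obtain rfl : i = 0 := by
        by_contra hi
        have := Nat.le_mul_of_pos_left k (Nat.pos_of_ne_zero hi)
        omega
      linarith [hinit n hn]
    · have step (j : ℕ) (hj : j * k ≤ n - k) : x n ≤ θ ^ (j + 1) * M + D / (1 - θ) := by
        have hsup : sSup (x '' Set.Icc (n - k) (n - 1)) ≤ θ ^ j * M + D / (1 - θ) := by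
          refine csSup_le ((Set.nonempty_Icc.2 (by omega)).image x) ?_
          rintro _ ⟨m, ⟨hm₁, hm₂⟩, rfl⟩
          exact ih m (by omega) j (hj.trans hm₁)
        calc x n ≤ θ * sSup (x '' Set.Icc (n - k) (n - 1)) + D := hrec n hn
          _ ≤ θ * (θ ^ j * M + D / (1 - θ)) + D := by gcongr
          _ = θ ^ (j + 1) * M + (θ * (D / (1 - θ)) + D) := by ring
          _ = θ ^ (j + 1) * M + D / (1 - θ) := by rw [hfix]
      cases i with
      | zero =>
        have := step 0 (by simp)
        have := mul_le_of_le_one_left hM hθ1.le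
        simp only [zero_add, pow_one, pow_zero, one_mul] at *
        linarith
      | succ j =>
        rw [add_one_mul] at hin
        exact step j (by omega)

/-- Windowed-iteration (absorption) lemma: if a nonnegative sequence satisfies
`x_n ≤ θ · max{x_{n−k}, …, x_{n−1}} + D` for all `n ≥ k` with `0 ≤ θ < 1`, then on the `i`-th
window of length `k` one has `x_n ≤ θ^i · max{x_0, …, x_{k−1}} + D/(1−θ)`; in particular the
whole sequence is bounded by `max{x_0, …, x_{k−1}} + D/(1−θ)`. -/
theorem windowed_iteration_bound
    (x : ℕ → ℝ) (hx : ∀ n, 0 ≤ x n) (k : ℕ) (hk : 1 ≤ k)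
    (θ D : ℝ) (hθ0 : 0 ≤ θ) (hθ1 : θ < 1) (hD : 0 ≤ D)
    (hrec : ∀ n, k ≤ n → x n ≤ θ * sSup (x '' Set.Icc (n - k) (n - 1)) + D) :
    (∀ i n, i * k ≤ n → n < (i + 1) * k →
      x n ≤ θ ^ i * sSup (x '' Set.Icc 0 (k - 1)) + D / (1 - θ)) ∧
    (∀ n, x n ≤ sSup (x '' Set.Icc 0 (k - 1)) + D / (1 - θ)) := by
  have hM : 0 ≤ sSup (x '' Set.Icc 0 (k - 1)) :=
    Real.sSup_nonneg (by rintro _ ⟨m, -, rfl⟩; exact hx m)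
  have hinit : ∀ n < k, x n ≤ sSup (x '' Set.Icc 0 (k - 1)) := fun n hn =>
    le_csSup ((Set.finite_Icc 0 (k - 1)).image x).bddAbove
      (Set.mem_image_of_mem x ⟨n.zero_le, by omega⟩)
  have key := le_pow_mul_add_of_window_rec hk hθ0 hθ1 hD hM hinit hrec
  exact ⟨fun i n hin _ => key i n hin, fun n => by simpa using key 0 n (by simp)⟩
end
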